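/- arXiv:1110.2960 — 4 statements merged into one kernel-verified Lean document; each statement's English description precedes it below -/
import Mathlib

section
/- Let p ≥ 2 and let u : ℝ → ℝ be a compactly supported Lipschitz function. Then for every real number κ, ∫_ℝ |u'(x) + κ u(x)|^p dx ≥ ∫_ℝ |(u^♯)'(x)|^p dx, where u' and (u^♯)' denote the almost-everywhere defined derivatives. -/
open MeasureTheory

/-- The symmetric decreasing rearrangement of `u : ℝ → ℝ`:
`u^♯(0) = sup |u|` and, for `x ≠ 0`,
`u^♯(x) = inf {t ≥ 0 : Leb{y : |u y| > t} < 2|x|}`. -/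
noncomputable def symmRearrange (u : ℝ → ℝ) : ℝ → ℝ := fun x =>
  if x = 0 then ⨆ y, |u y|
  else sInf {t : ℝ | 0 ≤ t ∧ volume {y : ℝ | t < |u y|} < ENNReal.ofReal (2 * |x|)}


/-- The pointwise inequality behind the drift estimate. -/
theorem two_mul_rpow_le_drift {p a b h s : ℝ} (hp : 2 ≤ p) (ha : 0 < a) (hb : 0 < b) (hh : 0 < h)
    (hab : h * (1 / a + 1 / b) ≤ 2) :
    2 * (h ^ p / h) ≤ |a + s| ^ p / a + |b - s| ^ p / b := by
  have hc : 0 < a * b := mul_pos ha hb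
  have bern : ∀ y : ℝ, (a * b) ^ (p / 2) * (1 + p / 2 * (y ^ 2 / (a * b) - 1)) ≤ |y| ^ p := by
    intro y
    have h1 := one_add_mul_self_le_rpow_one_add (s := y ^ 2 / (a * b) - 1) (p := p / 2)
      (by have : 0 ≤ y ^ 2 / (a * b) := by positivity
          linarith) (by linarith)
    calc _ ≤ (a * b) ^ (p / 2) * (1 + (y ^ 2 / (a * b) - 1)) ^ (p / 2) := by gcongr
      _ = (a * b * (y ^ 2 / (a * b))) ^ (p / 2) := by
        rw [Real.mul_rpow hc.le (by positivity)]; ring_nf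
      _ = |y| ^ p := by
        rw [mul_div_cancel₀ _ hc.ne', ← sq_abs, ← Real.rpow_natCast, ← Real.rpow_mul (abs_nonneg y)]
        congr 1; push_cast; ring
  have hlow : (a * b) ^ (p / 2) * (1 / a + 1 / b) ≤ |a + s| ^ p / a + |b - s| ^ p / b := by
    calc (a * b) ^ (p / 2) * (1 / a + 1 / b)
        ≤ (a * b) ^ (p / 2) * ((1 / a + 1 / b) + p / 2 / (a * b) * (s ^ 2 * (1 / a + 1 / b))) := by
          refine mul_le_mul_of_nonneg_left ?_ (by positivity)
          exact le_add_of_nonneg_right (by positivity)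
      _ = (a * b) ^ (p / 2) * (1 + p / 2 * ((a + s) ^ 2 / (a * b) - 1)) / a
          + (a * b) ^ (p / 2) * (1 + p / 2 * ((b - s) ^ 2 / (a * b) - 1)) / b := by
          field_simp; ring
      _ ≤ _ := by gcongr <;> exact bern _
  refine le_trans ?_ hlow
  have hab' : h * (a + b) ≤ 2 * (a * b) := by
    have : h * (1 / a + 1 / b) * (a * b) ≤ 2 * (a * b) := by gcongr
    calc h * (a + b) = h * (1 / a + 1 / b) * (a * b) := by field_simp; ring
      _ ≤ _ := this
  have hsq : h ^ 2 ≤ a * b := by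
    have h1 : (h * (a + b)) ^ 2 ≤ (2 * (a * b)) ^ 2 := by gcongr
    have h2 : h ^ 2 * (4 * (a * b)) ≤ h ^ 2 * (a + b) ^ 2 := by
      gcongr; nlinarith [sq_nonneg (a - b)]
    have h3 : h ^ 2 * (4 * (a * b)) ≤ (a * b) * (4 * (a * b)) := by nlinarith
    exact le_of_mul_le_mul_right h3 (by positivity)
  have hhsq : h ≤ √(a * b) := Real.le_sqrt_of_sq_le hsq
  have hinv : 2 / √(a * b) ≤ 1 / a + 1 / b := by
    have hs : 0 < √(a * b) := Real.sqrt_pos.2 hc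
    have hs2 : √(a * b) ^ 2 = a * b := Real.sq_sqrt hc.le
    rw [div_add_div _ _ ha.ne' hb.ne', div_le_div_iff₀ hs hc]
    have : 2 * √(a * b) ≤ a + b := by
      refine (sq_le_sq₀ (by positivity) (by positivity)).1 ?_
      nlinarith [sq_nonneg (a - b)]
    nlinarith
  have e : ∀ x : ℝ, 0 < x → x ^ p / x = x ^ (p - 1) := fun x hx => by
    rw [Real.rpow_sub hx, Real.rpow_one]
  calc 2 * (h ^ p / h) = 2 * h ^ (p - 1) := by rw [e h hh]
    _ ≤ 2 * √(a * b) ^ (p - 1) := by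
      gcongr; linarith
    _ = √(a * b) ^ p * (2 / √(a * b)) := by
      rw [← e _ (Real.sqrt_pos.2 hc)]; ring
    _ ≤ √(a * b) ^ p * (1 / a + 1 / b) := by gcongr
    _ = _ := by
      rw [Real.sqrt_eq_rpow, ← Real.rpow_mul hc.le]; congr 2; ring

section PolyaSzegoDrift

open Set Filter Topology
open scoped NNReal ENNReal

/-- Change of variables through an injective function with nonvanishing derivative, with a
measurable integrand on the image side. -/
theorem exists_measurable_lintegral_image {f : ℝ → ℝ} {E : Set ℝ} (hE : MeasurableSet E)
    (hd : ∀ x ∈ E, deriv f x ≠ 0) (hi : InjOn f E) {F : ℝ → ℝ≥0∞} (hF : Measurable F) :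
    MeasurableSet (f '' E) ∧ ∃ Φ : ℝ → ℝ≥0∞, Measurable Φ ∧
      (∀ x ∈ E, Φ (f x) = F x / ENNReal.ofReal |deriv f x|) ∧
      ∫⁻ t in f '' E, Φ t = ∫⁻ x in E, F x := by
  have hda : ∀ x ∈ E, HasDerivAt f (deriv f x) x := fun x hx =>
    (differentiableAt_of_deriv_ne_zero (hd x hx)).hasDerivAt
  have hc : ContinuousOn f E := fun x hx => (hda x hx).continuousAt.continuousWithinAt
  refine ⟨hE.image_of_continuousOn_injOn hc hi, ?_⟩
  obtain ⟨Φ, hΦ, hΦf⟩ := (hc.measurableEmbedding hE hi).exists_measurable_extend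
    (g := fun x : E => F x / ENNReal.ofReal |deriv f x|)
    (((hF.div (ENNReal.measurable_ofReal.comp (measurable_deriv f).abs))).comp
      measurable_subtype_coe) (fun _ => ⟨0⟩)
  have hval : ∀ x ∈ E, Φ (f x) = F x / ENNReal.ofReal |deriv f x| := fun x hx =>
    congrFun hΦf ⟨x, hx⟩
  refine ⟨Φ, hΦ, hval, ?_⟩
  rw [lintegral_image_eq_lintegral_abs_deriv_mul hE (fun x hx => (hda x hx).hasDerivWithinAt) hi]
  refine setLIntegral_congr_fun hE fun x hx => ?_
  simp only [hval x hx]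
  exact ENNReal.mul_div_cancel (by simpa using hd x hx) ENNReal.ofReal_ne_top

/-- Just to the left of a point with positive derivative, a function is slightly smaller. -/
theorem HasDerivAt.eventually_left {f : ℝ → ℝ} {a x c : ℝ} (hf : HasDerivAt f a x) (ha : 0 < a)
    (hc : 0 < c) (hca : c * a < 1) :
    ∀ᶠ η in 𝓝[>] (0 : ℝ), ∀ z ∈ Ioo (x - c * η) x, f x - η < f z ∧ f z < f x := by
  have hslope := hasDerivAt_iff_tendsto_slope.1 hf
  have h1 := hslope.eventually (Ioo_mem_nhds ha (show a < 1 / c by rwa [lt_div_iff₀' hc]))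
  obtain ⟨δ, hδ, h2⟩ := Metric.mem_nhdsWithin_iff.1 h1
  filter_upwards [Ioo_mem_nhdsGT (show 0 < δ / c by positivity)] with η hη z hz
  have hzx : 0 < x - z := sub_pos.2 hz.2
  have hηδ : c * η < δ := by rw [← lt_div_iff₀' hc]; exact hη.2
  have h3 := h2 ⟨by rw [Metric.mem_ball, dist_comm, Real.dist_eq, abs_of_pos hzx]
                    linarith [hz.1], hz.2.ne⟩
  simp only [mem_ofPred_eq, slope_def_field] at h3
  have e : (f z - f x) / (z - x) = (f x - f z) / (x - z) := by
    rw [← neg_sub (f x), ← neg_sub x, neg_div_neg_eq]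
  rw [e, lt_div_iff₀ hzx, div_lt_div_iff₀ hzx hc] at h3
  constructor
  · have : (f x - f z) * c < η * c := by linarith [hz.1, h3.2]
    have := lt_of_mul_lt_mul_right this hc.le
    linarith
  · linarith [h3.1]

/-- Just to the right of a point with negative derivative, a function is slightly smaller. -/
theorem HasDerivAt.eventually_right {f : ℝ → ℝ} {b x c : ℝ} (hf : HasDerivAt f (-b) x)
    (hb : 0 < b) (hc : 0 < c) (hcb : c * b < 1) :
    ∀ᶠ η in 𝓝[>] (0 : ℝ), ∀ z ∈ Ioo x (x + c * η), f x - η < f z ∧ f z < f x := by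
  have h : HasDerivAt (fun y => f (-y)) b (-x) := by
    have h0 : HasDerivAt f (-b) (- -x) := by rwa [neg_neg]
    simpa [Function.comp_def] using h0.scomp (-x) (hasDerivAt_neg (-x))
  filter_upwards [h.eventually_left hb hc hcb] with η hη z hz
  simpa using hη (-z) ⟨by linarith [hz.2], by linarith [hz.1]⟩

/-- Almost every value of a Lipschitz function is a regular value. -/
theorem LipschitzWith.ae_regular_value {C : ℝ≥0} {v : ℝ → ℝ} (hv : LipschitzWith C v) :
    ∀ᵐ t, ∀ x, v x = t → deriv v x ≠ 0 := by
  have h1 : volume (v '' {x | ¬ DifferentiableAt ℝ v x}) = 0 := by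
    have h := hv.hausdorffMeasure_image_le zero_le_one {x | ¬ DifferentiableAt ℝ v x}
    rw [hausdorffMeasure_real, ae_iff.1 hv.ae_differentiableAt_real, mul_zero] at h
    exact le_antisymm h bot_le
  have h2 : volume (v '' {x | DifferentiableAt ℝ v x ∧ deriv v x = 0}) = 0 := by
    refine addHaar_image_eq_zero_of_det_fderivWithin_eq_zero volume (f' := fun _ => 0)
      (fun x hx => ?_) (fun x _ => by simp [ContinuousLinearMap.det])
    have h := hx.1.hasDerivAt
    rw [hx.2] at h
    simpa using h.hasFDerivAt.hasFDerivWithinAt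
  rw [ae_iff]
  refine measure_mono_null ?_ (measure_union_null h1 h2)
  intro t ht
  simp only [mem_ofPred_eq, not_forall, not_not] at ht
  obtain ⟨x, rfl, hx⟩ := ht
  by_cases hd : DifferentiableAt ℝ v x
  · exact Or.inr ⟨x, ⟨hd, hx⟩, rfl⟩
  · exact Or.inl ⟨x, hd, rfl⟩

/-- The last point before `x₀` at which a continuous function takes a given lower value. -/
theorem Continuous.exists_last_crossing {v : ℝ → ℝ} (hv : Continuous v) {x₀ y t : ℝ}
    (hy : y ≤ x₀) (hyt : v y ≤ t) (ht : t < v x₀) :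
    ∃ α < x₀, v α = t ∧ ∀ z ∈ Icc α x₀, t ≤ v z := by
  have hcl : IsClosed {x | x ≤ x₀ ∧ v x ≤ t} :=
    isClosed_Iic.inter (isClosed_le hv continuous_const)
  have hbdd : BddAbove {x | x ≤ x₀ ∧ v x ≤ t} := ⟨x₀, fun x hx => hx.1⟩
  have hmem := hcl.csSup_mem ⟨y, hy, hyt⟩ hbdd
  set α := sSup {x | x ≤ x₀ ∧ v x ≤ t}
  have hlt : α < x₀ := lt_of_le_of_ne hmem.1 fun h => by
    rw [h] at hmem; exact absurd hmem.2 (not_le.2 ht)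
  have hgt : ∀ z, α < z → z ≤ x₀ → t ≤ v z := fun z hz hz' => by
    by_contra! h
    exact absurd (le_csSup hbdd ⟨hz', h.le⟩) (not_le.2 hz)
  have hα : t ≤ v α := by
    refine ge_of_tendsto ((hv.tendsto α).mono_left (nhdsWithin_le_nhds (s := Ioi α))) ?_
    filter_upwards [Ioo_mem_nhdsGT hlt] with z hz using hgt z hz.1 hz.2.le
  refine ⟨α, hlt, le_antisymm hmem.2 hα, fun z hz => ?_⟩
  rcases hz.1.eq_or_lt with rfl | h
  · exact hα
  · exact hgt z h hz.2

/-- The strict climbing points of `v` towards `x₀` where the later values stay above. -/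
theorem measurableSet_climbing {v : ℝ → ℝ} (hv : Continuous v) (x₀ : ℝ) :
    MeasurableSet {x | x < x₀ ∧ 0 < deriv v x ∧ ∀ z ∈ Icc x x₀, v x ≤ v z} := by
  have hcl : IsClosed {x | ∀ z ∈ Icc x x₀, v x ≤ v z} := by
    refine isClosed_of_closure_subset fun x hx z hz => ?_
    rcases hz.1.eq_or_lt with rfl | h
    · exact le_rfl
    · obtain ⟨s, hs, hsx⟩ := mem_closure_iff_seq_limit.1 hx
      refine le_of_tendsto ((hv.tendsto x).comp hsx) ?_
      filter_upwards [hsx.eventually_lt_const h] with n hn using hs n z ⟨hn.le, hz.2⟩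
  exact measurableSet_Iio.inter
    ((measurableSet_lt measurable_const (measurable_deriv v)).inter hcl.measurableSet)

theorem injOn_climbing {v : ℝ → ℝ} (x₀ : ℝ) :
    InjOn v {x | x < x₀ ∧ 0 < deriv v x ∧ ∀ z ∈ Icc x x₀, v x ≤ v z} := by
  have key : ∀ x y, (∀ z ∈ Icc x x₀, v x ≤ v z) → y < x₀ → 0 < deriv v y → v x = v y →
      ¬ x < y := by
    intro x y hx hy hd hxy hlt
    have hda := (differentiableAt_of_deriv_ne_zero hd.ne').hasDerivAt
    obtain ⟨η, h, hη⟩ := ((hda.eventually_left (c := 1 / (2 * deriv v y)) hd (by positivity)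
      (by field_simp; norm_num)).and self_mem_nhdsWithin).exists
    have hη' : 0 < 1 / (2 * deriv v y) * η := mul_pos (by positivity) hη
    obtain ⟨z, hz1, hz2⟩ := exists_between
      (show max x (y - 1 / (2 * deriv v y) * η) < y from max_lt hlt (by linarith))
    have h1 := (h z ⟨(le_max_right _ _).trans_lt hz1, hz2⟩).2
    have h2 := hx z ⟨((le_max_left _ _).trans_lt hz1).le, by linarith⟩
    linarith
  intro x hx y hy hxy
  exact le_antisymm (not_lt.1 (key y x hy.2.2 hx.1 hx.2.1 hxy.symm))
    (not_lt.1 (key x y hx.2.2 hy.1 hy.2.1 hxy))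

/-- Where `|u|` has nonzero derivative, passing to absolute values does not change the size of
the derivative with drift. -/
theorem abs_deriv_abs_add {u : ℝ → ℝ} (hu : Continuous u) {x : ℝ} (κ : ℝ)
    (hd : deriv (fun y => |u y|) x ≠ 0) :
    |deriv (fun y => |u y|) x + κ * (|u x|)| = |deriv u x + κ * u x| := by
  rcases lt_trichotomy (u x) 0 with h | h | h
  · have he : (fun y => |u y|) =ᶠ[𝓝 x] fun y => - u y := by
      filter_upwards [hu.continuousAt.eventually_lt_const h] with y hy using abs_of_neg hy
    rw [he.deriv_eq, deriv.fun_neg, abs_of_neg h, ← abs_neg]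
    ring_nf
  · refine absurd (IsLocalMin.deriv_eq_zero ?_) hd
    exact Eventually.of_forall fun y => by simp [h]
  · have he : (fun y => |u y|) =ᶠ[𝓝 x] u := by
      filter_upwards [hu.continuousAt.eventually_const_lt h] with y hy using abs_of_pos hy
    rw [he.deriv_eq, abs_of_pos h]

/-- One-sided coarea estimate: the drift energy to the left of `x₀` dominates an integral over
levels, taken along one increasing branch of `|u|`. -/
theorem exists_lintegral_levels_le {C : ℝ≥0} {u : ℝ → ℝ} (hu : LipschitzWith C u)
    (hs : HasCompactSupport u) (x₀ κ p : ℝ) :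
    ∃ Φ : ℝ → ℝ≥0∞, Measurable Φ ∧
      (∀ᵐ t, t ∈ Ioo 0 |u x₀| → ∃ α < x₀, ∃ a > 0, HasDerivAt (fun x => |u x|) a α ∧
        |u α| = t ∧ Φ t = ENNReal.ofReal (|a + κ * t| ^ p / a)) ∧
      ∫⁻ t in Ioo 0 |u x₀|, Φ t ≤ ∫⁻ x in Iio x₀, ENNReal.ofReal (|deriv u x + κ * u x| ^ p) := by
  set v : ℝ → ℝ := fun x => |u x| with hv
  have hvc : Continuous v := hu.continuous.abs
  have hvl : LipschitzWith (1 * C) v := by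
    have h1 : LipschitzWith 1 (fun x : ℝ => |x|) := by
      exact lipschitzWith_one_norm (E := ℝ)
    exact h1.comp hu
  obtain ⟨y, hyx, hy0⟩ : ∃ y ≤ x₀, v y = 0 := by
    obtain ⟨m, hm⟩ := hs.isCompact.bddBelow
    refine ⟨min x₀ (m - 1), min_le_left _ _, ?_⟩
    have : min x₀ (m - 1) ∉ tsupport u := fun h => by
      have h1 := hm h
      have h2 := min_le_right x₀ (m - 1)
      linarith
    simp [v, image_eq_zero_of_notMem_tsupport this]
  set E := {x | x < x₀ ∧ 0 < deriv v x ∧ ∀ z ∈ Icc x x₀, v x ≤ v z} with hE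
  have hF : Measurable fun x => ENNReal.ofReal (|deriv u x + κ * u x| ^ p) := by
    have h1 := measurable_deriv u
    have h2 := hu.continuous.measurable
    fun_prop
  have hEm : MeasurableSet E := measurableSet_climbing hvc x₀
  obtain ⟨him, Φ, hΦ, hval, hint⟩ := exists_measurable_lintegral_image hEm
    (fun x hx => hx.2.1.ne') (injOn_climbing x₀) hF
  have hbranch : ∀ᵐ t, t ∈ Ioo 0 (v x₀) → ∃ α ∈ E, v α = t := by
    filter_upwards [hvl.ae_regular_value] with t ht htI
    obtain ⟨α, hα, hαt, hge⟩ := hvc.exists_last_crossing hyx (hy0.trans_le htI.1.le) htI.2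
    refine ⟨α, ⟨hα, ?_, fun z hz => hαt.trans_le (hge z hz)⟩, hαt⟩
    have hne := ht α hαt
    by_contra hcon
    have hneg : 0 < - deriv v α := neg_pos.2 (lt_of_le_of_ne (not_lt.1 hcon) hne)
    have hda := (differentiableAt_of_deriv_ne_zero hne).hasDerivAt
    rw [← neg_neg (deriv v α)] at hda
    obtain ⟨η, h, hη⟩ := ((hda.eventually_right (c := 1 / (2 * - deriv v α)) hneg (by positivity)
      (by field_simp; norm_num)).and self_mem_nhdsWithin).exists
    have hη' : 0 < 1 / (2 * - deriv v α) * η := mul_pos (by positivity) hη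
    obtain ⟨z, hz1, hz2⟩ := exists_between
      (show α < min x₀ (α + 1 / (2 * - deriv v α) * η) from lt_min hα (by linarith))
    have h1 := (h z ⟨hz1, hz2.trans_le (min_le_right _ _)⟩).2
    have h2 := hge z ⟨hz1.le, (hz2.trans_le (min_le_left _ _)).le⟩
    linarith
  refine ⟨Φ, hΦ, ?_, ?_⟩
  · filter_upwards [hbranch] with t ht htI
    obtain ⟨α, hα, rfl⟩ := ht htI
    refine ⟨α, hα.1, deriv v α, hα.2.1,
      (differentiableAt_of_deriv_ne_zero hα.2.1.ne').hasDerivAt, rfl, ?_⟩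
    rw [hval α hα, ← abs_deriv_abs_add hu.continuous κ hα.2.1.ne', abs_of_pos hα.2.1,
      ← ENNReal.ofReal_div_of_pos hα.2.1]
  · calc ∫⁻ t in Ioo 0 (v x₀), Φ t ≤ ∫⁻ t in v '' E, Φ t :=
          lintegral_mono_set' (by
            filter_upwards [hbranch] with t ht htI using ht htI)
      _ = ∫⁻ x in E, _ := hint
      _ ≤ _ := lintegral_mono_set fun x hx => hx.1

theorem symmRearrange_of_pos (u : ℝ → ℝ) {x : ℝ} (hx : 0 < x) :
    symmRearrange u x =
      sInf {t : ℝ | 0 ≤ t ∧ volume {y : ℝ | t < |u y|} < ENNReal.ofReal (2 * x)} := by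
  rw [symmRearrange, if_neg hx.ne', abs_of_pos hx]

theorem symmRearrange_neg (u : ℝ → ℝ) (x : ℝ) : symmRearrange u (-x) = symmRearrange u x := by
  simp [symmRearrange]

theorem mem_symmRearrange_set_of_bound {u : ℝ → ℝ} {M x : ℝ} (hM : 0 ≤ M) (hu : ∀ y, |u y| ≤ M)
    (hx : 0 < x) :
    M ∈ {t : ℝ | 0 ≤ t ∧ volume {y : ℝ | t < |u y|} < ENNReal.ofReal (2 * x)} := by
  have : {y : ℝ | M < |u y|} = ∅ := by
    ext y; simpa using hu y
  exact ⟨hM, by rw [this, measure_empty]; simpa using hx⟩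

theorem symmRearrange_mem_Icc {u : ℝ → ℝ} {M x : ℝ} (hM : 0 ≤ M) (hu : ∀ y, |u y| ≤ M)
    (hx : 0 < x) : symmRearrange u x ∈ Icc 0 M := by
  rw [symmRearrange_of_pos u hx]
  exact ⟨Real.sInf_nonneg fun t ht => ht.1,
    csInf_le ⟨0, fun t ht => ht.1⟩ (mem_symmRearrange_set_of_bound hM hu hx)⟩

theorem antitoneOn_symmRearrange {u : ℝ → ℝ} {M : ℝ} (hM : 0 ≤ M) (hu : ∀ y, |u y| ≤ M) :
    AntitoneOn (symmRearrange u) (Ioi 0) := by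
  intro x hx y hy hxy
  rw [symmRearrange_of_pos u hx, symmRearrange_of_pos u hy]
  exact csInf_le_csInf ⟨0, fun t ht => ht.1⟩ ⟨M, mem_symmRearrange_set_of_bound hM hu hx⟩
    fun t ht => ⟨ht.1, ht.2.trans_le (by gcongr)⟩

theorem le_symmRearrange {u : ℝ → ℝ} {M s x : ℝ} (hM : 0 ≤ M) (hu : ∀ y, |u y| ≤ M)
    (hx : 0 < x) (h : ENNReal.ofReal (2 * x) ≤ volume {y | s < |u y|}) :
    s ≤ symmRearrange u x := by
  rw [symmRearrange_of_pos u hx]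
  refine le_csInf ⟨M, mem_symmRearrange_set_of_bound hM hu hx⟩ fun τ hτ => ?_
  by_contra! hlt
  refine absurd (h.trans (measure_mono ?_)) (not_le.2 hτ.2)
  exact fun y hy => hlt.trans hy

theorem le_volume_symmRearrange_le {u : ℝ → ℝ} (hu : Continuous u) (hs : HasCompactSupport u)
    {x : ℝ} (hx : 0 < x) (ht : 0 < symmRearrange u x) :
    ENNReal.ofReal (2 * x) ≤ volume {y | symmRearrange u x ≤ |u y|} := by
  set t := symmRearrange u x with htdef
  have hlevel : ∀ τ, 0 ≤ τ → τ < t → ENNReal.ofReal (2 * x) ≤ volume {y | τ < |u y|} := by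
    intro τ h0 hτ
    by_contra! h
    rw [htdef, symmRearrange_of_pos u hx] at hτ
    exact notMem_of_lt_csInf hτ ⟨0, fun t ht => ht.1⟩ ⟨h0, h⟩
  obtain ⟨s, hsm, hsI, hst⟩ := exists_seq_strictMono_tendsto' ht
  have hset : {y | t ≤ |u y|} = ⋂ n, {y | s n < |u y|} := by
    ext y
    simp only [mem_ofPred_eq, mem_iInter]
    exact ⟨fun h n => (hsI n).2.trans_le h, fun h => le_of_tendsto' hst fun n => (h n).le⟩
  have hfin : volume {y | s 0 < |u y|} ≠ ∞ := by
    refine ((measure_mono fun y hy => subset_tsupport u ?_).trans_lt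
      hs.isCompact.measure_lt_top).ne
    rw [Function.mem_support]
    intro h
    rw [mem_ofPred_eq, h, abs_zero] at hy
    exact absurd (hsI 0).1 (not_lt.2 hy.le)
  have hlim := tendsto_measure_iInter_atTop (μ := volume) (s := fun n => {y | s n < |u y|})
    (fun n => (measurableSet_lt measurable_const hu.abs.measurable).nullMeasurableSet)
    (fun m n hmn y hy => (hsm.monotone hmn).trans_lt hy) ⟨0, hfin⟩
  rw [hset]
  exact ge_of_tendsto' hlim fun n => hlevel _ (hsI n).1.le (hsI n).2

/-- The slope of the rearrangement is at most the harmonic mean of the slopes of `|u|` at two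
points on the same level. -/
theorem neg_deriv_symmRearrange_mul_le {u : ℝ → ℝ} (hu : Continuous u)
    (hs : HasCompactSupport u) {M : ℝ} (hM : 0 ≤ M) (hb : ∀ y, |u y| ≤ M)
    {x α β a b d : ℝ} (hx : 0 < x) (ht : 0 < symmRearrange u x)
    (hd : HasDerivAt (symmRearrange u) d x) (hαβ : α < β) (ha : 0 < a) (hb0 : 0 < b)
    (hα : HasDerivAt (fun y => |u y|) a α) (hβ : HasDerivAt (fun y => |u y|) (-b) β)
    (hαt : |u α| = symmRearrange u x) (hβt : |u β| = symmRearrange u x) :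
    -d * (1 / a + 1 / b) ≤ 2 := by
  have main : ∀ θ ∈ Ioo (0 : ℝ) 1, -d * (θ * (1 / a + 1 / b)) ≤ 2 := by
    intro θ hθ
    set c := θ / a with hc
    set e := θ / b with he
    have hc0 : 0 < c := div_pos hθ.1 ha
    have he0 : 0 < e := div_pos hθ.1 hb0
    set k := (c + e) / 2 with hk
    have hk0 : 0 < k := by positivity
    have hca : c * a < 1 := by rw [hc, div_mul_cancel₀ _ ha.ne']; exact hθ.2
    have heb : e * b < 1 := by rw [he, div_mul_cancel₀ _ hb0.ne']; exact hθ.2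
    have hmu : ∀ᶠ η in 𝓝[>] (0 : ℝ), symmRearrange u x - η ≤ symmRearrange u (x + k * η) := by
      filter_upwards [hα.eventually_left ha hc0 hca, hβ.eventually_right hb0 he0 heb,
        self_mem_nhdsWithin] with η h1 h2 hη
      have hη0 : 0 < η := hη
      refine le_symmRearrange hM hb (by positivity) ?_
      set t := symmRearrange u x
      have hA : MeasurableSet {y | t ≤ |u y|} := measurableSet_le measurable_const
        hu.abs.measurable
      have hdisj : Disjoint (Ioo (α - c * η) α) (Ioo β (β + e * η)) :=
        disjoint_left.2 fun z hz hz' => by linarith [hz.2, hz'.1]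
      have hdisj' : Disjoint (Ioo (α - c * η) α ∪ Ioo β (β + e * η)) {y | t ≤ |u y|} := by
        refine disjoint_left.2 fun z hz hz' => ?_
        rcases hz with hz | hz
        · exact absurd ((h1 z hz).2.trans_eq hαt) (not_lt.2 hz')
        · exact absurd ((h2 z hz).2.trans_eq hβt) (not_lt.2 hz')
      calc ENNReal.ofReal (2 * (x + k * η))
          = ENNReal.ofReal (c * η) + ENNReal.ofReal (e * η) + ENNReal.ofReal (2 * x) := by
            rw [← ENNReal.ofReal_add (by positivity) (by positivity),
              ← ENNReal.ofReal_add (by positivity) (by positivity)]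
            congr 1; rw [hk]; ring
        _ ≤ volume (Ioo (α - c * η) α) + volume (Ioo β (β + e * η))
            + volume {y | t ≤ |u y|} := by
            gcongr
            · rw [Real.volume_Ioo]; apply le_of_eq; congr 1; ring
            · rw [Real.volume_Ioo]; apply le_of_eq; congr 1; ring
            · exact le_volume_symmRearrange_le hu hs hx ht
        _ = volume ((Ioo (α - c * η) α ∪ Ioo β (β + e * η)) ∪ {y | t ≤ |u y|}) := by
            rw [measure_union hdisj' hA, measure_union hdisj measurableSet_Ioo]
        _ ≤ _ := by
            refine measure_mono fun z hz => ?_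
            rcases hz with (hz | hz) | hz
            · exact (show t - η < |u z| by rw [← hαt]; exact (h1 z hz).1)
            · exact (show t - η < |u z| by rw [← hβt]; exact (h2 z hz).1)
            · exact (show t - η < |u z| from lt_of_lt_of_le (by linarith) hz)
    have hcomp : HasDerivAt (fun η => symmRearrange u (x + k * η)) (d * k) 0 := by
      have h0 : HasDerivAt (fun η : ℝ => x + k * η) k 0 := by
        simpa using ((hasDerivAt_id (0 : ℝ)).const_mul k).const_add x
      have hd' : HasDerivAt (symmRearrange u) d (x + k * 0) := by simpa using hd
      exact hd'.comp 0 h0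
    have hslope := (hasDerivAt_iff_tendsto_slope.1 hcomp).mono_left
      (nhdsWithin_mono (0 : ℝ) (fun y (hy : y ∈ Ioi (0 : ℝ)) => (ne_of_gt hy : y ≠ 0)))
    have hge : -1 ≤ d * k := by
      refine ge_of_tendsto hslope ?_
      filter_upwards [hmu, self_mem_nhdsWithin] with η h1 hη
      have hη0 : 0 < η := hη
      rw [slope_def_field, sub_zero, le_div_iff₀ hη0]
      simp only [mul_zero, add_zero]
      linarith
    have : -d * (θ * (1 / a + 1 / b)) = -2 * (d * k) := by rw [hk, hc, he]; ring
    linarith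
  have hlim : Tendsto (fun θ : ℝ => -d * (θ * (1 / a + 1 / b))) (𝓝[<] 1)
      (𝓝 (-d * (1 * (1 / a + 1 / b)))) :=
    (Continuous.tendsto (by fun_prop) 1).mono_left nhdsWithin_le_nhds
  rw [one_mul] at hlim
  refine le_of_tendsto hlim ?_
  filter_upwards [Ioo_mem_nhdsLT (zero_lt_one (α := ℝ))] with θ hθ using main θ hθ

/-- An antitone function is injective on the set where its derivative does not vanish. -/
theorem AntitoneOn.injOn_deriv_ne_zero {g : ℝ → ℝ} (hg : AntitoneOn g (Ioi 0)) :
    InjOn g {x | 0 < x ∧ deriv g x ≠ 0} := by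
  have key : ∀ x y, 0 < x → deriv g x ≠ 0 → g x = g y → ¬ x < y := by
    intro x y hx hd hxy hlt
    have hda := (differentiableAt_of_deriv_ne_zero hd).hasDerivAt
    have hconst : ∀ z ∈ Icc x y, g z = g x := fun z hz =>
      le_antisymm (hg hx (hx.trans_le hz.1) hz.1)
        (hxy.trans_le (hg (hx.trans_le hz.1) (hx.trans hlt) hz.2))
    have h0 : HasDerivWithinAt g 0 (Icc x y) x :=
      (hasDerivWithinAt_const x (Icc x y) (g x)).congr hconst rfl
    exact hd ((uniqueDiffOn_Icc hlt x (left_mem_Icc.2 hlt.le)).eq_deriv _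
      hda.hasDerivWithinAt h0)
  intro x hx y hy hxy
  exact le_antisymm (not_lt.1 (key y x hy.1 hy.2 hxy.symm)) (not_lt.1 (key x y hx.1 hx.2 hxy))

theorem AntitoneOn.deriv_nonpos_of_pos {g : ℝ → ℝ} (hg : AntitoneOn g (Ioi 0)) {x : ℝ}
    (hx : 0 < x) : deriv g x ≤ 0 := by
  rw [← derivWithin_of_isOpen isOpen_Ioi hx]
  exact hg.derivWithin_nonpos

theorem setLIntegral_Iio_comp_neg (F : ℝ → ℝ≥0∞) (c : ℝ) :
    ∫⁻ x in Iio (-c), F (-x) = ∫⁻ x in Ioi c, F x := by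
  have h := (Measure.measurePreserving_neg (volume : Measure ℝ)).setLIntegral_comp_preimage_emb
    (Homeomorph.neg ℝ).measurableEmbedding F (Ioi c)
  simpa using h

theorem lintegral_Iio_add_Ioi (F : ℝ → ℝ≥0∞) (c : ℝ) :
    (∫⁻ x in Iio c, F x) + ∫⁻ x in Ioi c, F x = ∫⁻ x, F x := by
  rw [setLIntegral_congr Ioi_ae_eq_Ici, ← compl_Iio]
  exact lintegral_add_compl F measurableSet_Iio

theorem measurableSet_pos_deriv_ne_zero (g : ℝ → ℝ) :
    MeasurableSet {x | 0 < x ∧ deriv g x ≠ 0} :=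
  measurableSet_Ioi.inter ((measurable_deriv g) (measurableSet_singleton 0).compl)

theorem lintegral_deriv_symmRearrange (u : ℝ → ℝ) {p : ℝ} (hp : 0 < p) :
    ∫⁻ x, ENNReal.ofReal (|deriv (symmRearrange u) x| ^ p) =
      2 * ∫⁻ x in {x | 0 < x ∧ deriv (symmRearrange u) x ≠ 0},
        ENNReal.ofReal (|deriv (symmRearrange u) x| ^ p) := by
  have hneg : ∀ x, deriv (symmRearrange u) (-x) = -deriv (symmRearrange u) x := fun x => by
    have h := deriv_comp_neg (symmRearrange u) x
    simp only [symmRearrange_neg] at h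
    rw [h, neg_neg]
  rw [← lintegral_Iio_add_Ioi _ 0]
  have h1 := setLIntegral_Iio_comp_neg
    (fun x => ENNReal.ofReal (|deriv (symmRearrange u) x| ^ p)) 0
  simp only [hneg, abs_neg, neg_zero] at h1
  rw [h1, ← two_mul]
  congr 1
  rw [← lintegral_indicator measurableSet_Ioi, ← lintegral_indicator
    (measurableSet_pos_deriv_ne_zero _)]
  congr with x
  by_cases hd : deriv (symmRearrange u) x = 0 <;>
    simp [indicator, hd, Real.zero_rpow hp.ne']

theorem lintegral_deriv_symmRearrange_le {C : ℝ≥0} {u : ℝ → ℝ} (hu : LipschitzWith C u)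
    (hs : HasCompactSupport u) {p : ℝ} (hp : 2 ≤ p) (κ : ℝ) :
    ∫⁻ x, ENNReal.ofReal (|deriv (symmRearrange u) x| ^ p) ≤
      ∫⁻ x, ENNReal.ofReal (|deriv u x + κ * u x| ^ p) := by
  obtain ⟨x₀, hmax⟩ : ∃ x₀, ∀ y, |u y| ≤ |u x₀| :=
    hu.continuous.abs.exists_forall_ge_of_hasCompactSupport (hs.comp_left abs_zero)
  set M := |u x₀| with hMdef
  have hM : 0 ≤ M := abs_nonneg _
  have hu' : LipschitzWith (C * 1) (fun x => u (-x)) := hu.comp (LipschitzWith.id.neg)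
  have hs' : HasCompactSupport (fun x => u (-x)) := hs.comp_homeomorph (Homeomorph.neg ℝ)
  obtain ⟨Φ, hΦ, hΦv, hΦi⟩ := exists_lintegral_levels_le hu hs x₀ κ p
  obtain ⟨Θ, hΘ, hΘv, hΘi⟩ := exists_lintegral_levels_le hu' hs' (-x₀) (-κ) p
  simp only [neg_neg, ← hMdef] at hΦv hΦi hΘv hΘi
  have hΘi' : ∫⁻ t in Ioo 0 M, Θ t ≤
      ∫⁻ x in Ioi x₀, ENNReal.ofReal (|deriv u x + κ * u x| ^ p) := by
    rw [← setLIntegral_Iio_comp_neg]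
    refine hΘi.trans_eq ?_
    congr with x
    rw [deriv_comp_neg, ← abs_neg]
    ring_nf
  have hanti := antitoneOn_symmRearrange hM hmax
  set g := symmRearrange u with hg
  set G := {x | 0 < x ∧ deriv g x ≠ 0} with hG
  have hGm : MeasurableSet G := measurableSet_pos_deriv_ne_zero g
  have hgF : Measurable fun x => ENNReal.ofReal (|deriv g x| ^ p) := by
    have h1 := measurable_deriv g
    fun_prop
  obtain ⟨him, Ψ, hΨ, hΨv, hΨi⟩ := exists_measurable_lintegral_image hGm
    (fun x hx => hx.2) hanti.injOn_deriv_ne_zero hgF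
  have hsub : g '' G ≤ᵐ[volume] Ioo 0 M := by
    refine (LE.le.eventuallyLE ?_).trans Ioo_ae_eq_Icc.symm.le
    rintro _ ⟨x, hx, rfl⟩
    exact symmRearrange_mem_Icc hM hmax hx.1
  have hpt : ∀ᵐ t, t ∈ g '' G → 2 * Ψ t ≤ Φ t + Θ t := by
    filter_upwards [hΦv, hΘv, hsub] with t h1 h2 h3 ht
    have htI : t ∈ Ioo 0 M := h3 ht
    obtain ⟨α, hα, a, ha, hda, hαt, hΦt⟩ := h1 htI
    obtain ⟨β, hβ, b, hb, hdb, hβt, hΘt⟩ := h2 htI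
    obtain ⟨x, hx, rfl⟩ := ht
    have hdg := (differentiableAt_of_deriv_ne_zero hx.2).hasDerivAt
    have hdb' : HasDerivAt (fun y => |u y|) (-b) (-β) := by
      have h0 : HasDerivAt (fun y => |u (-y)|) b (- -β) := by rwa [neg_neg]
      simpa [Function.comp_def] using h0.scomp (-β) (hasDerivAt_neg (-β))
    have hneg : 0 < -deriv g x :=
      neg_pos.2 (lt_of_le_of_ne (hanti.deriv_nonpos_of_pos hx.1) hx.2)
    have hharm := neg_deriv_symmRearrange_mul_le hu.continuous hs hM hmax hx.1 htI.1 hdg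
      (hα.trans (lt_neg_of_lt_neg hβ)) ha hb hda hdb' hαt hβt
    have hineq := two_mul_rpow_le_drift (s := κ * g x) hp ha hb hneg hharm
    rw [hΨv x hx, hΦt, hΘt, abs_of_neg (neg_pos.1 hneg), ← ENNReal.ofReal_div_of_pos hneg,
      ← ENNReal.ofReal_add (by positivity) (by positivity), ← ENNReal.ofReal_ofNat 2,
      ← ENNReal.ofReal_mul (by norm_num)]
    refine ENNReal.ofReal_le_ofReal (hineq.trans_eq ?_)
    rw [neg_mul, ← sub_eq_add_neg]
  calc ∫⁻ x, ENNReal.ofReal (|deriv g x| ^ p)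
      = 2 * ∫⁻ t in g '' G, Ψ t := by
        rw [lintegral_deriv_symmRearrange u (by linarith), hΨi]
    _ = ∫⁻ t in g '' G, 2 * Ψ t := (lintegral_const_mul _ hΨ).symm
    _ ≤ ∫⁻ t in g '' G, (Φ t + Θ t) := setLIntegral_mono_ae' him hpt
    _ ≤ ∫⁻ t in Ioo 0 M, (Φ t + Θ t) := lintegral_mono_set' hsub
    _ = (∫⁻ t in Ioo 0 M, Φ t) + ∫⁻ t in Ioo 0 M, Θ t := lintegral_add_left hΦ _
    _ ≤ _ := add_le_add hΦi hΘi'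
    _ = _ := lintegral_Iio_add_Ioi _ x₀

theorem lintegral_drift_ne_top {C : ℝ≥0} {u : ℝ → ℝ} (hu : LipschitzWith C u)
    (hs : HasCompactSupport u) {p : ℝ} (hp : 0 < p) (κ : ℝ) :
    ∫⁻ x, ENNReal.ofReal (|deriv u x + κ * u x| ^ p) ≠ ∞ := by
  obtain ⟨M, hM⟩ := hs.exists_bound_of_continuous hu.continuous
  have hsupp : Function.support (fun x => ENNReal.ofReal (|deriv u x + κ * u x| ^ p)) ⊆
      tsupport u := by
    intro x hx
    by_contra h
    refine hx ?_
    have h1 : u x = 0 := image_eq_zero_of_notMem_tsupport h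
    have h2 : deriv u x = 0 := by
      by_contra h2
      exact h (support_deriv_subset h2)
    simp [h1, h2, Real.zero_rpow hp.ne']
  rw [← setLIntegral_eq_of_support_subset hsupp]
  refine (setLIntegral_lt_top_of_le_nnreal hs.isCompact.measure_ne_top
    ⟨Real.toNNReal ((C + |κ| * M) ^ p), fun x _ => ?_⟩).ne
  refine ENNReal.ofReal_le_ofReal (Real.rpow_le_rpow (abs_nonneg _) ?_ hp.le)
  calc |deriv u x + κ * u x| ≤ |deriv u x| + |κ * u x| := abs_add_le _ _
    _ ≤ C + |κ| * M := by
      rw [abs_mul]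
      gcongr
      · exact norm_deriv_le_of_lipschitz hu
      · exact hM x

end PolyaSzegoDrift

/-- **Proposition 2.1 (Pólya–Szegő type inequality with drift).**
For `p ≥ 2`, every compactly supported Lipschitz `u : ℝ → ℝ` and every `κ ∈ ℝ` satisfy
`∫ |u' + κ u|^p ≥ ∫ |(u^♯)'|^p`. -/
theorem polyaSzego_drift
    (p : ℝ) (hp : 2 ≤ p)
    (u : ℝ → ℝ) (C : NNReal) (hu_lip : LipschitzWith C u)
    (hu_supp : HasCompactSupport u) (κ : ℝ) :
    ∫ x : ℝ, |deriv u x + κ * u x| ^ p ≥ ∫ x : ℝ, |deriv (symmRearrange u) x| ^ p := by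
  have h1 := measurable_deriv u
  have h2 := hu_lip.continuous.measurable
  have h3 := measurable_deriv (symmRearrange u)
  rw [ge_iff_le,
    integral_eq_lintegral_of_nonneg_ae (.of_forall fun x => by positivity)
      (by fun_prop : Measurable _).aestronglyMeasurable,
    integral_eq_lintegral_of_nonneg_ae (.of_forall fun x => by positivity)
      (by fun_prop : Measurable _).aestronglyMeasurable]
  exact ENNReal.toReal_mono (lintegral_drift_ne_top hu_lip hu_supp (by linarith) κ)
    (lintegral_deriv_symmRearrange_le hu_lip hu_supp hp κ)
end

section
/- Let p ≥ 2, κ ∈ ℝ, L > 0, and let u be a Lipschitz function on [0, L] with u(0) = u(L) = 0. Then there exists a nonnegative Lipschitz function ũ on [0, L] with ũ(0) = ũ(L) = 0 such that ∫₀^L e^{κx} |u'(x)|^p dx ≥ ∫₀^L |ũ'(x)|^p dx and ∫₀^L e^{κx} |u(x)|^p dx = ∫₀^L |ũ(x)|^p dx, where u' and ũ' denote the almost-everywhere defined derivatives. -/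
open MeasureTheory

/-- A primitive of `1 / H`, with `H` positive and continuous, has an inverse solving `S' = H ∘ S`. -/
lemma exists_inverse_primitive {H : ℝ → ℝ} (hH : Continuous H) (hpos : ∀ s, 0 < H s) :
    ∃ S : ℝ → ℝ, ∀ s, S (∫ t in (0:ℝ)..s, (H t)⁻¹) = s ∧
      HasDerivAt S (H s) (∫ t in (0:ℝ)..s, (H t)⁻¹) := by
  have hc : Continuous fun t => (H t)⁻¹ := hH.inv₀ fun t => (hpos t).ne'
  set τ : ℝ → ℝ := fun s => ∫ t in (0:ℝ)..s, (H t)⁻¹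
  have hd : ∀ s, HasStrictDerivAt τ (H s)⁻¹ s := fun s =>
    intervalIntegral.integral_hasStrictDerivAt_right (hc.intervalIntegrable _ _)
      hc.stronglyMeasurable.stronglyMeasurableAtFilter hc.continuousAt
  have hmono : StrictMono τ := strictMono_of_hasDerivAt_pos (fun s => (hd s).hasDerivAt)
    fun s => inv_pos.2 (hpos s)
  have hleft : ∀ s, Function.invFun τ (τ s) = s := Function.leftInverse_invFun hmono.injective
  refine ⟨Function.invFun τ, fun s => ⟨hleft s, ?_⟩⟩
  have hne : (H s)⁻¹ ≠ 0 := inv_ne_zero (hpos s).ne'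
  have hmap := (hd s).map_nhds_eq hne
  have hcont : ContinuousAt (Function.invFun τ) (τ s) := by
    rw [ContinuousAt, hleft, ← hmap, Filter.tendsto_map'_iff]
    exact Filter.tendsto_id.congr fun t => (hleft t).symm
  have hright : ∀ᶠ y in nhds (τ s), τ (Function.invFun τ y) = y := by
    rw [← hmap, Filter.eventually_map]
    exact Filter.Eventually.of_forall fun t => by rw [hleft]
  have := HasDerivAt.of_local_left_inverse hcont (f' := (H s)⁻¹)
    (by rw [hleft]; exact (hd s).hasDerivAt) hne hright
  rwa [inv_inv] at this

lemma integrableOn_weight_mul_abs_deriv_rpow {p κ a b : ℝ} (hp : 0 ≤ p) {U : ℝ → ℝ} {C : NNReal}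
    (hU : LipschitzWith C U) :
    IntegrableOn (fun x => Real.exp (κ * x) * |deriv U x| ^ p) (Set.Icc a b) := by
  have hexp : Continuous fun x => Real.exp (κ * x) := by fun_prop
  refine (hexp.continuousOn.integrableOn_compact isCompact_Icc).mul_bdd
    (c := (C : ℝ) ^ p) ?_ (Filter.Eventually.of_forall fun x => ?_)
  · exact ((measurable_deriv U).abs.pow_const p).aestronglyMeasurable
  · rw [Real.norm_of_nonneg (by positivity)]
    exact Real.rpow_le_rpow (abs_nonneg _) (norm_deriv_le_of_lipschitz hU) hp

lemma mul_abs_rpow_mul_le {p q : ℝ} (hpq : p.HolderConjugate q) (f y z : ℝ) :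
    f * (p * |y| ^ (p - 2) * y * z) ≤ |z| ^ p + (p - 1) * |f| ^ q * |y| ^ p := by
  have hp := hpq.lt
  have hY := Real.young_inequality z (f * |y| ^ (p - 2) * y) hpq
  have h2 : |f * |y| ^ (p - 2) * y| ^ q = |f| ^ q * |y| ^ p := by
    rcases eq_or_ne y 0 with rfl | hy
    · simp [Real.zero_rpow hpq.symm.ne_zero, Real.zero_rpow hpq.ne_zero]
    · have hy' : 0 < |y| := abs_pos.2 hy
      have : |f * |y| ^ (p - 2) * y| = |f| * |y| ^ (p - 1) := by
        rw [abs_mul, abs_mul, abs_of_pos (Real.rpow_pos_of_pos hy' _), mul_assoc]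
        congr 1
        nth_rewrite 2 [← Real.rpow_one |y|]
        rw [← Real.rpow_add hy']
        ring_nf
      rw [this, Real.mul_rpow (abs_nonneg _) (by positivity), ← Real.rpow_mul hy'.le,
        hpq.sub_one_mul_conj]
  rw [h2] at hY
  have h3 : p / q = p - 1 := by
    have := hpq.symm.ne_zero
    rw [div_eq_iff this, hpq.sub_one_mul_conj]
  calc f * (p * |y| ^ (p - 2) * y * z) = p * (z * (f * |y| ^ (p - 2) * y)) := by ring
    _ ≤ p * (|z| ^ p / p + |f| ^ q * |y| ^ p / q) := by gcongr
    _ = |z| ^ p + (p / q) * |f| ^ q * |y| ^ p := by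
        have := hpq.ne_zero
        field_simp
    _ = _ := by rw [h3]

/-- A bounded supersolution of the Riccati equation of the weighted `p`-Laplacian yields a weighted
Wirtinger inequality. -/
lemma weighted_wirtinger_of_riccati {p q κ L lam : ℝ} (hpq : p.HolderConjugate q) (hL : 0 ≤ L)
    {U : ℝ → ℝ} {C : NNReal} (hU : LipschitzWith C U) (hU0 : U 0 = 0) (hUL : U L = 0)
    {F F' : ℝ → ℝ} {K : NNReal} (hF : ∀ x ∈ Set.Icc 0 L, HasDerivAt F (F' x) x)
    (hK : ∀ x ∈ Set.Icc 0 L, ‖F' x‖₊ ≤ K)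
    (hric : ∀ x ∈ Set.Icc 0 L, F' x + (lam + κ * F x + (p - 1) * |F x| ^ q) ≤ 0) :
    lam * ∫ x in Set.Icc 0 L, Real.exp (κ * x) * |U x| ^ p ≤
      ∫ x in Set.Icc 0 L, Real.exp (κ * x) * |deriv U x| ^ p := by
  have hp := hpq.lt
  have hu : Set.uIcc 0 L = Set.Icc 0 L := Set.uIcc_of_le hL
  have hacF : AbsolutelyContinuousOnInterval F 0 L := by
    refine LipschitzOnWith.absolutelyContinuousOnInterval (K := K) ?_
    rw [hu]
    exact Convex.lipschitzOnWith_of_nnnorm_hasDerivWithin_le (convex_Icc 0 L)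
      (fun x hx => (hF x hx).hasDerivWithinAt) hK
  have hacE : AbsolutelyContinuousOnInterval (fun x => Real.exp (κ * x)) 0 L :=
    ContDiffOn.absolutelyContinuousOnInterval (by fun_prop)
  have hacU : AbsolutelyContinuousOnInterval (fun x => |U x| ^ p) 0 L := by
    obtain ⟨M, hM⟩ := isCompact_Icc.exists_bound_of_continuousOn (hU.continuous.continuousOn
      (s := Set.Icc 0 L))
    obtain ⟨D, hD⟩ := (contDiff_norm_rpow (E := ℝ) hp).contDiffOn.exists_lipschitzOnWith
      one_ne_zero (convex_Icc (-M) M) isCompact_Icc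
    refine LipschitzOnWith.absolutelyContinuousOnInterval (K := D * C) ?_
    rw [hu]
    exact hD.comp hU.lipschitzOnWith fun x hx => abs_le.1 (hM x hx)
  have hac := (hacF.mul hacE).mul hacU
  have hftc := hac.integral_deriv_eq_sub
  have hint := hac.intervalIntegrable_deriv
  have hcU : Continuous U := hU.continuous
  have hz : (0:ℝ) ^ p = 0 := Real.zero_rpow hpq.ne_zero
  simp only [Pi.mul_apply, hU0, hUL, abs_zero, hz, mul_zero, sub_zero] at hftc
  rw [intervalIntegral.integral_of_le hL, ← integral_Icc_eq_integral_Ioc] at hftc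
  rw [intervalIntegrable_iff_integrableOn_Icc_of_le hL] at hint
  have hi1 : IntegrableOn (fun x => Real.exp (κ * x) * |U x| ^ p) (Set.Icc 0 L) := by
    refine ContinuousOn.integrableOn_compact isCompact_Icc (Continuous.continuousOn ?_)
    exact (by fun_prop : Continuous fun x => Real.exp (κ * x)).mul
      (hcU.abs.rpow_const fun x => Or.inr hpq.nonneg)
  have hi2 := integrableOn_weight_mul_abs_deriv_rpow (κ := κ) (a := 0) (b := L) hpq.nonneg hU
  rw [← sub_nonneg, ← integral_const_mul, ← integral_sub hi2 (hi1.const_mul lam)]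
  refine hftc.ge.trans (integral_mono_ae hint (hi2.sub (hi1.const_mul lam)) ?_)
  filter_upwards [ae_restrict_of_ae hU.ae_differentiableAt_real, ae_restrict_mem measurableSet_Icc]
    with x hx hxI
  have hdE : HasDerivAt (fun x => Real.exp (κ * x)) (Real.exp (κ * x) * κ) x := by
    simpa using ((hasDerivAt_id x).const_mul κ).exp
  have hdU := (hasDerivAt_abs_rpow (U x) hp).comp x hx.hasDerivAt
  have hd := ((hF x hxI).mul hdE).mul hdU
  have hd' : deriv (F * (fun x => Real.exp (κ * x)) * fun x => |U x| ^ p) x = _ := hd.deriv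
  rw [hd']
  have h1 := mul_abs_rpow_mul_le hpq (F x) (U x) (deriv U x)
  have h2 := mul_le_mul_of_nonneg_right (hric x hxI) (by positivity : 0 ≤ |U x| ^ p)
  simp only [Function.comp_apply, Pi.mul_apply]
  have h3 := mul_le_mul_of_nonneg_left (add_le_add h1 h2) (Real.exp_nonneg (κ * x))
  linarith
lemma exists_riccati_solution {p q κ L lam R : ℝ} (hp : 1 < p) (hq : 0 < q) (hlam : 0 < lam)
    (hR : 0 ≤ R) (hint : L ≤ 2 * ∫ t in (0:ℝ)..R, (lam + (p - 1) * |t| ^ q)⁻¹) :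
    ∃ (F F' : ℝ → ℝ) (K : NNReal), (∀ x ∈ Set.Icc 0 L, HasDerivAt F (F' x) x) ∧
      (∀ x ∈ Set.Icc 0 L, ‖F' x‖₊ ≤ K) ∧
      ∀ x ∈ Set.Icc 0 L, F' x + (lam + κ * F x + (p - 1) * |F x| ^ q) ≤ 0 := by
  set H : ℝ → ℝ := fun s => lam + κ * s + (p - 1) * |s| ^ q with hHdef
  have habs : Continuous fun s : ℝ => |s| ^ q := continuous_abs.rpow_const fun _ => Or.inr hq.le
  have hH : Continuous H := by fun_prop
  by_cases hpos : ∀ s, 0 < H s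
  swap
  · push Not at hpos
    obtain ⟨s, hs⟩ := hpos
    exact ⟨fun _ => s, fun _ => 0, 0, fun x _ => hasDerivAt_const x s, by simp,
      fun x _ => by simpa using hs⟩
  obtain ⟨S, hS⟩ := exists_inverse_primitive hH hpos
  have hc : Continuous fun t => (H t)⁻¹ := hH.inv₀ fun t => (hpos t).ne'
  have hc0 : Continuous fun t : ℝ => (lam + (p - 1) * |t| ^ q)⁻¹ :=
    Continuous.inv₀ (by fun_prop) fun t => by
      have : 0 ≤ (p - 1) * |t| ^ q := mul_nonneg (by linarith) (by positivity)
      linarith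
  set τ : ℝ → ℝ := fun s => ∫ t in (0:ℝ)..s, (H t)⁻¹
  have hτ : Continuous τ := intervalIntegral.continuous_primitive
    (fun a b => hc.intervalIntegrable a b) 0
  have htotal : L ≤ τ R - τ (-R) := by
    have hneg : τ (-R) = -∫ t in (0:ℝ)..R, (H (-t))⁻¹ := by
      rw [intervalIntegral.integral_comp_neg (fun t => (H t)⁻¹), neg_zero,
        ← intervalIntegral.integral_symm]
    have hc' : Continuous fun t => (H (-t))⁻¹ := hc.comp continuous_neg
    rw [hneg, sub_neg_eq_add, ← intervalIntegral.integral_add (hc.intervalIntegrable _ _)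
      (hc'.intervalIntegrable _ _)]
    refine hint.trans ?_
    rw [← intervalIntegral.integral_const_mul]
    refine intervalIntegral.integral_mono_on hR ((hc0.const_mul 2).intervalIntegrable _ _)
      ((hc.add hc').intervalIntegrable _ _) fun t _ => ?_
    have h1 := hpos t
    have h2 := hpos (-t)
    have h3 : lam + (p - 1) * |t| ^ q = (H t + H (-t)) / 2 := by
      simp only [hHdef, abs_neg]; ring
    rw [h3]
    field_simp
    nlinarith [sq_nonneg (H t - H (-t))]
  obtain ⟨M, hM⟩ := isCompact_Icc.exists_bound_of_continuousOn (hH.continuousOn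
    (s := Set.Icc (-R) R))
  have key : ∀ x ∈ Set.Icc 0 L, ∃ s ∈ Set.Icc (-R) R, τ s = τ R - x := fun x hx =>
    intermediate_value_Icc (by linarith) hτ.continuousOn ⟨by linarith [hx.2], by linarith [hx.1]⟩
  refine ⟨fun x => S (τ R - x), fun x => -H (S (τ R - x)), M.toNNReal, fun x hx => ?_,
    fun x hx => ?_, fun x _ => (neg_add_cancel (H (S (τ R - x)))).le⟩
  · obtain ⟨s, -, hs⟩ := key x hx
    have h := hS s
    change S (τ s) = s ∧ HasDerivAt S (H s) (τ s) at h
    rw [hs] at h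
    beta_reduce
    rw [h.1]
    exact h.2.comp_const_sub (τ R) x
  · obtain ⟨s, hsR, hs⟩ := key x hx
    beta_reduce
    rw [← hs, show S (τ s) = s from (hS s).1, nnnorm_neg]
    exact NNReal.le_toNNReal_of_coe_le (hM s hsR)

lemma weighted_wirtinger {p q κ L lam R : ℝ} (hpq : p.HolderConjugate q) (hL : 0 ≤ L)
    (hlam : 0 < lam) (hR : 0 ≤ R)
    (hint : L ≤ 2 * ∫ t in (0:ℝ)..R, (lam + (p - 1) * |t| ^ q)⁻¹)
    {U : ℝ → ℝ} {C : NNReal} (hU : LipschitzWith C U) (hU0 : U 0 = 0) (hUL : U L = 0) :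
    lam * ∫ x in Set.Icc 0 L, Real.exp (κ * x) * |U x| ^ p ≤
      ∫ x in Set.Icc 0 L, Real.exp (κ * x) * |deriv U x| ^ p := by
  obtain ⟨F, F', K, hF, hK, hric⟩ :=
    exists_riccati_solution (κ := κ) hpq.lt hpq.symm.pos hlam hR hint
  exact weighted_wirtinger_of_riccati hpq hL hU hU0 hUL hF hK hric

/-- The minimal Dirichlet eigenvalue of the `p`-Laplacian on an interval of length `L`,
characterised by the blow-up time of the Riccati equation. -/
lemma exists_eigenvalue {p q L : ℝ} (hpq : p.HolderConjugate q) (hL : 0 < L) :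
    ∃ lam > 0,
      IntegrableOn (fun t : ℝ => (lam + (p - 1) * |t| ^ q)⁻¹) (Set.Ioi 0) ∧
      ∫ t in Set.Ioi (0:ℝ), (lam + (p - 1) * |t| ^ q)⁻¹ = L / 2 ∧
      ∀ mu, 0 < mu → mu < lam →
        ∃ R ≥ 0, L ≤ 2 * ∫ t in (0:ℝ)..R, (mu + (p - 1) * |t| ^ q)⁻¹ := by
  have hp := hpq.lt
  have hq := hpq.symm.lt
  have hp1 : 0 < p - 1 := by linarith
  have hpos : ∀ {mu : ℝ}, 0 < mu → ∀ t : ℝ, 0 < mu + (p - 1) * |t| ^ q := fun hmu t => by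
    positivity
  have hcont : ∀ {mu : ℝ}, 0 < mu → Continuous fun t : ℝ => (mu + (p - 1) * |t| ^ q)⁻¹ :=
    fun {mu} hmu => Continuous.inv₀
      (continuous_const.add ((continuous_abs.rpow_const fun _ => Or.inr (by linarith)).const_mul _))
      fun t => (hpos hmu t).ne'
  have hintg : ∀ {mu : ℝ}, 0 < mu →
      IntegrableOn (fun t : ℝ => (mu + (p - 1) * |t| ^ q)⁻¹) (Set.Ioi 0) := fun {mu} hmu => by
    rw [← Set.Ioc_union_Ioi_eq_Ioi zero_le_one]
    refine (((hcont hmu).continuousOn.integrableOn_compact isCompact_Icc).mono_set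
      Set.Ioc_subset_Icc_self).union ?_
    refine ((integrableOn_Ioi_rpow_of_lt (a := -q) (by linarith) zero_lt_one).const_mul
      (p - 1)⁻¹).mono' (hcont hmu).aestronglyMeasurable ?_
    filter_upwards [ae_restrict_mem measurableSet_Ioi] with t ht
    have ht0 : (0:ℝ) < t := lt_trans zero_lt_one ht
    rw [Real.norm_of_nonneg (inv_pos.2 (hpos hmu t)).le, Real.rpow_neg ht0.le, ← mul_inv,
      abs_of_pos ht0]
    gcongr
    linarith
  set I : ℝ := ∫ t in Set.Ioi (0:ℝ), (1 + (p - 1) * |t| ^ q)⁻¹ with hI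
  have hscale : ∀ {mu : ℝ}, 0 < mu →
      ∫ t in Set.Ioi (0:ℝ), (mu + (p - 1) * |t| ^ q)⁻¹ = mu ^ (-p⁻¹) * I := fun {mu} hmu => by
    have hb : 0 < mu ^ (-q⁻¹) := by positivity
    have h := integral_comp_mul_left_Ioi (fun t : ℝ => (1 + (p - 1) * |t| ^ q)⁻¹) 0 hb
    rw [mul_zero, ← hI, smul_eq_mul] at h
    have h2 : ∀ t : ℝ, (mu + (p - 1) * |t| ^ q)⁻¹ =
        mu⁻¹ * (1 + (p - 1) * |mu ^ (-q⁻¹) * t| ^ q)⁻¹ := fun t => by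
      rw [abs_mul, abs_of_pos hb, Real.mul_rpow hb.le (abs_nonneg t), ← Real.rpow_mul hmu.le,
        neg_mul, inv_mul_cancel₀ hpq.symm.ne_zero, Real.rpow_neg_one, ← mul_inv]
      congr 1
      field_simp
    simp_rw [h2]
    rw [integral_const_mul, h, ← mul_assoc, ← Real.rpow_neg hmu.le, neg_neg, ← Real.rpow_neg_one,
      ← Real.rpow_add hmu]
    congr 2
    linarith [hpq.inv_add_inv_eq_one]
  have hIpos : 0 < I := by
    refine (setIntegral_pos_iff_support_of_nonneg_ae
      (Filter.Eventually.of_forall fun t => (inv_pos.2 (hpos one_pos t)).le)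
      (hintg one_pos)).2 ?_
    have : (Function.support fun t : ℝ => (1 + (p - 1) * |t| ^ q)⁻¹) = Set.univ :=
      Set.eq_univ_of_forall fun t => (inv_pos.2 (hpos one_pos t)).ne'
    rw [this]
    simp
  have hlam : 0 < (2 * I / L) ^ p := by positivity
  have hval : ((2 * I / L) ^ p) ^ (-p⁻¹) * I = L / 2 := by
    rw [← Real.rpow_mul (by positivity), mul_neg, mul_inv_cancel₀ hpq.ne_zero, Real.rpow_neg_one]
    field_simp
  refine ⟨(2 * I / L) ^ p, hlam, hintg hlam, (hscale hlam).trans hval, fun mu hmu hlt => ?_⟩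
  have hgt : L / 2 < ∫ t in Set.Ioi (0:ℝ), (mu + (p - 1) * |t| ^ q)⁻¹ := by
    rw [hscale hmu, ← hval]
    have := Real.rpow_lt_rpow_of_neg hmu hlt (neg_lt_zero.2 hpq.inv_pos)
    gcongr
  have hlim := intervalIntegral_tendsto_integral_Ioi 0 (hintg hmu) Filter.tendsto_id
  obtain ⟨R, hR, hR0⟩ := ((hlim.eventually_const_lt hgt).and (Filter.eventually_ge_atTop 0)).exists
  exact ⟨R, hR0, by simp only [id] at hR; linarith⟩

lemma tendsto_div_add_mul_abs_rpow {c lam q : ℝ} (hc : 0 < c) (hlam : 0 < lam) (hq : 1 < q)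
    {α : Type*} {l : Filter α} {G : α → ℝ} (hG : Filter.Tendsto (fun x => |G x|) l Filter.atTop) :
    Filter.Tendsto (fun x => G x / (lam + c * |G x| ^ q)) l (nhds 0) := by
  have h := ((tendsto_rpow_neg_atTop (y := q - 1) (by linarith)).comp hG).const_mul c⁻¹
  rw [mul_zero] at h
  refine squeeze_zero_norm' ?_ h
  filter_upwards [hG.eventually_gt_atTop 0] with x hx
  have hH : 0 < lam + c * |G x| ^ q := by positivity
  rw [Real.norm_eq_abs, abs_div, abs_of_pos hH, Function.comp_apply, neg_sub,
    Real.rpow_sub hx, Real.rpow_one]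
  calc |G x| / (lam + c * |G x| ^ q) ≤ |G x| / (c * |G x| ^ q) := by gcongr; linarith
    _ = c⁻¹ * (|G x| / |G x| ^ q) := by field_simp

/-- The blow-up solution of the unweighted Riccati equation on `(0, L)`. -/
lemma exists_blowup_riccati_solution {c lam q L : ℝ} (hc : 0 < c) (hlam : 0 < lam) (hq : 1 < q)
    (hint : IntegrableOn (fun t : ℝ => (lam + c * |t| ^ q)⁻¹) (Set.Ioi 0))
    (hval : ∫ t in Set.Ioi (0:ℝ), (lam + c * |t| ^ q)⁻¹ = L / 2) :
    ∃ G : ℝ → ℝ, (∀ x ∈ Set.Ioo 0 L, HasDerivAt G (lam + c * |G x| ^ q) x) ∧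
      Filter.Tendsto G (nhdsWithin 0 (Set.Ioi 0)) Filter.atBot ∧
      Filter.Tendsto G (nhdsWithin L (Set.Iio L)) Filter.atTop := by
  set H : ℝ → ℝ := fun s => lam + c * |s| ^ q with hHdef
  have hpos : ∀ s, 0 < H s := fun s => by positivity
  have hH : Continuous H :=
    continuous_const.add ((continuous_abs.rpow_const fun _ => Or.inr (by linarith)).const_mul _)
  have hci : Continuous fun t => (H t)⁻¹ := hH.inv₀ fun t => (hpos t).ne'
  obtain ⟨S, hS⟩ := exists_inverse_primitive hH hpos
  set τ : ℝ → ℝ := fun s => ∫ t in (0:ℝ)..s, (H t)⁻¹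
  have hτ : Continuous τ := intervalIntegral.continuous_primitive
    (fun a b => hci.intervalIntegrable a b) 0
  have hmono : StrictMono τ := strictMono_of_hasDerivAt_pos
    (fun s => hci.integral_hasStrictDerivAt 0 s |>.hasDerivAt) fun s => inv_pos.2 (hpos s)
  have htop : Filter.Tendsto τ Filter.atTop (nhds (L / 2)) := by
    rw [← hval]
    exact intervalIntegral_tendsto_integral_Ioi 0 hint Filter.tendsto_id
  have hodd : ∀ s, τ (-s) = -τ s := fun s => by
    have h := intervalIntegral.integral_comp_neg (a := 0) (b := s) (fun t => (H t)⁻¹)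
    rw [neg_zero, intervalIntegral.integral_symm 0 (-s)] at h
    simp only [hHdef, abs_neg] at h
    simp only [τ, hHdef]
    linarith
  have hbot : Filter.Tendsto τ Filter.atBot (nhds (-(L / 2))) := by
    refine (htop.comp Filter.tendsto_neg_atBot_atTop).neg.congr fun s => ?_
    rw [Function.comp_apply, hodd, neg_neg]
  have hlt : ∀ s, τ s < L / 2 := fun s =>
    (hmono (lt_add_one s)).trans_le (hmono.monotone.ge_of_tendsto htop (s + 1))
  have hgt : ∀ s, -(L / 2) < τ s := fun s => by
    have := hlt (-s)
    rw [hodd] at this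
    linarith
  have key : ∀ x ∈ Set.Ioo 0 L, ∃ s, τ s = x - L / 2 := fun x hx => by
    obtain ⟨a, ha⟩ := (hbot.eventually_lt_const
      (show -(L / 2) < x - L / 2 by linarith [hx.1])).exists
    obtain ⟨b, hb⟩ := (htop.eventually_const_lt
      (show x - L / 2 < L / 2 by linarith [hx.2])).exists
    exact mem_range_of_exists_le_of_exists_ge hτ ⟨a, ha.le⟩ ⟨b, hb.le⟩
  have hSτ : ∀ s, S (τ s) = s := fun s => (hS s).1
  refine ⟨fun x => S (x - L / 2), fun x hx => ?_, Filter.tendsto_atBot.2 fun M => ?_,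
    Filter.tendsto_atTop.2 fun M => ?_⟩
  · obtain ⟨s, hs⟩ := key x hx
    have h : HasDerivAt S (H s) (τ s) := (hS s).2
    rw [hs] at h
    beta_reduce
    rw [← hSτ s, hs] at h
    exact h.comp_sub_const x (L / 2)
  · filter_upwards [Ioo_mem_nhdsGT (show 0 < τ M + L / 2 by linarith [hgt M])] with x hx
    obtain ⟨s, hs⟩ := key x ⟨hx.1, by linarith [hx.2, hlt M]⟩
    rw [← hs, hSτ]
    exact (hmono.lt_iff_lt.1 (by linarith [hx.2])).le
  · filter_upwards [Ioo_mem_nhdsLT (show τ M + L / 2 < L by linarith [hlt M])] with x hx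
    obtain ⟨s, hs⟩ := key x ⟨by linarith [hx.1, hgt M], hx.2⟩
    rw [← hs, hSτ]
    exact (hmono.lt_iff_lt.1 (by linarith [hx.1])).le

/-- The first Dirichlet eigenfunction of the `p`-Laplacian on `[0, L]`. -/
lemma exists_eigenfunction {p q lam L : ℝ} (hpq : p.HolderConjugate q) (hL : 0 < L)
    (hlam : 0 < lam)
    (hint : IntegrableOn (fun t : ℝ => (lam + (p - 1) * |t| ^ q)⁻¹) (Set.Ioi 0))
    (hval : ∫ t in Set.Ioi (0:ℝ), (lam + (p - 1) * |t| ^ q)⁻¹ = L / 2) :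
    ∃ w : ℝ → ℝ, (∃ K : NNReal, LipschitzOnWith K w (Set.Icc 0 L)) ∧ (∀ x, 0 ≤ w x) ∧
      w 0 = 0 ∧ w L = 0 ∧ 0 < ∫ x in Set.Icc 0 L, |w x| ^ p ∧
      ∫ x in Set.Icc 0 L, |derivWithin w (Set.Icc 0 L) x| ^ p =
        lam * ∫ x in Set.Icc 0 L, |w x| ^ p := by
  have hp := hpq.lt
  have hq := hpq.symm.lt
  have hp1 : 0 < p - 1 := by linarith
  obtain ⟨G, hG, hG0, hGL⟩ := exists_blowup_riccati_solution hp1 hlam hq hint hval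
  set H : ℝ → ℝ := fun s => lam + (p - 1) * |s| ^ q with hHdef
  have hpos : ∀ s, 0 < H s := fun s => by positivity
  have hH : Continuous H :=
    continuous_const.add ((continuous_abs.rpow_const fun _ => Or.inr (by linarith)).const_mul _)
  have hdH : ∀ s, HasDerivAt H (p * |s| ^ (q - 2) * s) s := fun s => by
    convert! ((hasDerivAt_abs_rpow s hq).const_mul (p - 1)).const_add lam using 1
    linear_combination (-(|s| ^ (q - 2) * s)) * hpq.sub_one_mul_conj
  have hGc : ContinuousOn G (Set.Ioo 0 L) := fun x hx =>
    (hG x hx).continuousAt.continuousWithinAt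
  have hHG : ∀ {l : Filter ℝ}, Filter.Tendsto (fun x => |G x|) l Filter.atTop →
      Filter.Tendsto (fun x => H (G x)) l Filter.atTop := fun h =>
    Filter.tendsto_atTop_add_const_left _ _
      (((tendsto_rpow_atTop (by linarith)).comp h).const_mul_atTop hp1)
  have hr : 0 < p⁻¹ := hpq.inv_pos
  set w : ℝ → ℝ := fun x => if x ∈ Set.Ioo 0 L then H (G x) ^ (-p⁻¹) else 0
  have hw : ∀ x ∈ Set.Ioo 0 L, w x = H (G x) ^ (-p⁻¹) := fun x hx => if_pos hx
  have hw0 : w 0 = 0 := if_neg fun h => lt_irrefl _ h.1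
  have hwL : w L = 0 := if_neg fun h => lt_irrefl _ h.2
  have hnonneg : ∀ x, 0 ≤ w x := fun x => by
    by_cases hx : x ∈ Set.Ioo 0 L
    · rw [hw x hx]
      exact Real.rpow_nonneg (hpos _).le _
    · exact (if_neg hx).ge
  have hdw : ∀ x ∈ Set.Ioo 0 L,
      HasDerivAt w (-(|G x| ^ (q - 2) * G x * H (G x) ^ (-p⁻¹))) x := fun x hx => by
    have h := ((hdH (G x)).comp x (hG x hx)).rpow_const (p := -p⁻¹) (Or.inl (hpos _).ne')
    have heq : w =ᶠ[nhds x] fun y => (H ∘ G) y ^ (-p⁻¹) :=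
      Filter.eventuallyEq_of_mem (isOpen_Ioo.mem_nhds hx) hw
    convert! h.congr_of_eventuallyEq heq using 1
    rw [Function.comp_apply, Real.rpow_sub_one (hpos _).ne']
    have h1 := (hpos (G x)).ne'
    have h2 := hpq.ne_zero
    change _ = p * |G x| ^ (q - 2) * G x * H (G x) * -p⁻¹ * (H (G x) ^ (-p⁻¹) / H (G x))
    field_simp
  have hwp : ∀ x ∈ Set.Ioo 0 L, |w x| ^ p = (H (G x))⁻¹ := fun x hx => by
    rw [abs_of_nonneg (hnonneg x), hw x hx, ← Real.rpow_mul (hpos _).le, neg_mul,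
      inv_mul_cancel₀ hpq.ne_zero, Real.rpow_neg_one]
  have hdwp : ∀ x ∈ Set.Ioo 0 L,
      |-(|G x| ^ (q - 2) * G x * H (G x) ^ (-p⁻¹))| ^ p = |G x| ^ q / H (G x) := fun x hx => by
    rw [abs_neg, ← hw x hx, abs_mul, Real.mul_rpow (abs_nonneg _) (abs_nonneg _), hwp x hx,
      div_eq_mul_inv]
    congr 1
    rcases eq_or_ne (G x) 0 with h0 | h0
    · simp [h0, Real.zero_rpow hpq.symm.ne_zero, Real.zero_rpow hpq.ne_zero]
    · have h0' : 0 < |G x| := abs_pos.2 h0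
      rw [abs_mul, abs_of_nonneg (Real.rpow_nonneg h0'.le _)]
      nth_rewrite 2 [← Real.rpow_one |G x|]
      rw [← Real.rpow_add h0', ← Real.rpow_mul h0'.le]
      congr 1
      linarith [hpq.symm.sub_one_mul_conj]
  have hle : ∀ s, |s| ^ q / H s ≤ (p - 1)⁻¹ := fun s => by
    rw [div_le_iff₀ (hpos s), inv_mul_eq_div, le_div_iff₀ hp1]
    simp only [hHdef]
    linarith
  have hGabs0 := Filter.tendsto_abs_atBot_atTop.comp hG0
  have hGabsL := Filter.tendsto_abs_atTop_atTop.comp hGL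
  have hcont : ContinuousOn w (Set.Icc 0 L) := by
    intro x hx
    rcases hx.1.eq_or_lt with rfl | h0
    · have h : ContinuousWithinAt w (Set.Ioi 0) 0 := by
        rw [ContinuousWithinAt, hw0]
        exact ((tendsto_rpow_neg_atTop hr).comp (hHG hGabs0)).congr'
          (Filter.eventuallyEq_of_mem (Ioo_mem_nhdsGT hL) fun y hy => (hw y hy).symm)
      exact (continuousWithinAt_Ioi_iff_Ici.1 h).mono Set.Icc_subset_Ici_self
    rcases hx.2.eq_or_lt with rfl | h1
    · have h : ContinuousWithinAt w (Set.Iio x) x := by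
        rw [ContinuousWithinAt, hwL]
        exact ((tendsto_rpow_neg_atTop hr).comp (hHG hGabsL)).congr'
          (Filter.eventuallyEq_of_mem (Ioo_mem_nhdsLT hL) fun y hy => (hw y hy).symm)
      exact (continuousWithinAt_Iio_iff_Iic.1 h).mono Set.Icc_subset_Iic_self
    · exact (hdw x ⟨h0, h1⟩).continuousAt.continuousWithinAt
  have hlip : LipschitzOnWith (((p - 1)⁻¹ ^ p⁻¹).toNNReal) w (Set.Icc 0 L) := by
    rw [← closure_Ioo hL.ne] at hcont ⊢
    refine LipschitzOnWith.closure hcont (Convex.lipschitzOnWith_of_nnnorm_hasDerivWithin_le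
      (convex_Ioo 0 L) (fun x hx => (hdw x hx).hasDerivWithinAt) fun x hx => ?_)
    refine NNReal.le_toNNReal_of_coe_le ?_
    rw [coe_nnnorm, Real.norm_eq_abs,
      Real.le_rpow_inv_iff_of_pos (abs_nonneg _) (by positivity) hpq.pos, hdwp x hx]
    exact hle _
  have hi1 : IntegrableOn (fun x => (H (G x))⁻¹) (Set.Ioo 0 L) := by
    refine Integrable.of_bound (C := lam⁻¹)
      ((ContinuousOn.inv₀ (hH.comp_continuousOn hGc) fun x _ => (hpos _).ne').aestronglyMeasurable
        measurableSet_Ioo) (Filter.Eventually.of_forall fun x => ?_)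
    rw [Real.norm_of_nonneg (inv_pos.2 (hpos _)).le]
    exact inv_anti₀ hlam (le_add_of_nonneg_right (by positivity))
  have hi2 : IntegrableOn (fun x => |G x| ^ q / H (G x)) (Set.Ioo 0 L) := by
    refine Integrable.of_bound (C := (p - 1)⁻¹)
      ((ContinuousOn.div (hGc.abs.rpow_const fun _ _ => Or.inr hpq.symm.nonneg)
        (hH.comp_continuousOn hGc) fun x _ => (hpos _).ne').aestronglyMeasurable
        measurableSet_Ioo) (Filter.Eventually.of_forall fun x => ?_)
    rw [Real.norm_of_nonneg (div_nonneg (by positivity) (hpos _).le)]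
    exact hle _
  have hftc : ∫ x in (0:ℝ)..L, (lam * (H (G x))⁻¹ - |G x| ^ q / H (G x)) = 0 - 0 := by
    refine intervalIntegral.integral_eq_sub_of_hasDerivAt_of_tendsto hL
      (f := fun x => G x / H (G x)) (fun x hx => ?_) ?_
      (tendsto_div_add_mul_abs_rpow hp1 hlam hq hGabs0)
      (tendsto_div_add_mul_abs_rpow hp1 hlam hq hGabsL)
    · have h := (hG x hx).div ((hdH (G x)).comp x (hG x hx)) (hpos _).ne'
      convert! h using 1
      have h1 := (hpos (G x)).ne'
      have h2 : |G x| ^ (q - 2) * G x * G x = |G x| ^ q := by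
        rcases eq_or_ne (G x) 0 with h0 | h0
        · simp [h0, Real.zero_rpow hpq.symm.ne_zero]
        · rw [mul_assoc, ← abs_mul_abs_self, ← sq, ← Real.rpow_natCast,
            ← Real.rpow_add (abs_pos.2 h0)]
          simp
      simp only [Function.comp_apply]
      change _ = (H (G x) * H (G x) - G x * (p * |G x| ^ (q - 2) * G x * H (G x))) / H (G x) ^ 2
      rw [show G x * (p * |G x| ^ (q - 2) * G x * H (G x)) =
        p * (|G x| ^ (q - 2) * G x * G x) * H (G x) by ring, h2]
      field_simp
      simp only [hHdef]
      ring
    · rw [intervalIntegrable_iff_integrableOn_Ioo_of_le hL.le]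
      exact (hi1.const_mul lam).sub hi2
  rw [intervalIntegral.integral_of_le hL.le, integral_Ioc_eq_integral_Ioo,
    integral_sub (hi1.const_mul lam) hi2, integral_const_mul, sub_zero, sub_eq_zero] at hftc
  have hIw : ∫ x in Set.Icc 0 L, |w x| ^ p = ∫ x in Set.Ioo 0 L, (H (G x))⁻¹ := by
    rw [integral_Icc_eq_integral_Ioo]
    exact setIntegral_congr_fun measurableSet_Ioo hwp
  have hIdw : ∫ x in Set.Icc 0 L, |derivWithin w (Set.Icc 0 L) x| ^ p =
      ∫ x in Set.Ioo 0 L, |G x| ^ q / H (G x) := by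
    rw [integral_Icc_eq_integral_Ioo]
    refine setIntegral_congr_fun measurableSet_Ioo fun x hx => ?_
    rw [derivWithin_of_mem_nhds (Icc_mem_nhds hx.1 hx.2), (hdw x hx).deriv, hdwp x hx]
  refine ⟨w, ⟨_, hlip⟩, hnonneg, hw0, hwL, ?_, by rw [hIw, hIdw, hftc]⟩
  rw [hIw]
  refine (setIntegral_pos_iff_support_of_nonneg_ae
    (Filter.Eventually.of_forall fun x => (inv_pos.2 (hpos _)).le) hi1).2 ?_
  have : (Function.support fun x => (H (G x))⁻¹) = Set.univ :=
    Set.eq_univ_of_forall fun x => (inv_pos.2 (hpos _)).ne'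
  rw [this]
  simpa using hL

/-- **Lemma 3.3.** Let `p ≥ 2`, `κ ∈ ℝ`, `L > 0` and let `u` be Lipschitz on `[0,L]` with
`u(0) = u(L) = 0`. Then there is a nonnegative Lipschitz `ũ` on `[0,L]`, vanishing at the
endpoints, with `∫₀^L e^{κx}|u'|^p ≥ ∫₀^L |ũ'|^p` and `∫₀^L e^{κx}|u|^p = ∫₀^L |ũ|^p`. -/
theorem exponential_weight_absorption
    (p κ L : ℝ) (hp : 2 ≤ p) (hL : 0 < L)
    (u : ℝ → ℝ) (C : NNReal) (hu_lip : LipschitzOnWith C u (Set.Icc 0 L))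
    (hu0 : u 0 = 0) (huL : u L = 0) :
    ∃ v : ℝ → ℝ, (∃ C' : NNReal, LipschitzOnWith C' v (Set.Icc 0 L)) ∧
      (∀ x ∈ Set.Icc (0:ℝ) L, 0 ≤ v x) ∧ v 0 = 0 ∧ v L = 0 ∧
      (∫ x in Set.Icc (0:ℝ) L, Real.exp (κ * x) * |derivWithin u (Set.Icc 0 L) x| ^ p ≥
        ∫ x in Set.Icc (0:ℝ) L, |derivWithin v (Set.Icc 0 L) x| ^ p) ∧
      (∫ x in Set.Icc (0:ℝ) L, Real.exp (κ * x) * |u x| ^ p =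
        ∫ x in Set.Icc (0:ℝ) L, |v x| ^ p) := by
  have hpq : p.HolderConjugate (p / (p - 1)) := Real.HolderConjugate.conjExponent (by linarith)
  obtain ⟨lam, hlam, hint, hval, hlt⟩ := exists_eigenvalue hpq hL
  obtain ⟨w, ⟨K, hwlip⟩, hw, hw0, hwL, hwpos, hweq⟩ := exists_eigenfunction hpq hL hlam hint hval
  obtain ⟨U, hU, hUu⟩ := hu_lip.extend_real
  have hE : ∫ x in Set.Icc (0:ℝ) L, Real.exp (κ * x) * |derivWithin u (Set.Icc 0 L) x| ^ p =
      ∫ x in Set.Icc (0:ℝ) L, Real.exp (κ * x) * |deriv U x| ^ p := by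
    simp_rw [integral_Icc_eq_integral_Ioo]
    refine setIntegral_congr_fun measurableSet_Ioo fun x hx => ?_
    rw [derivWithin_congr hUu (hUu (Set.Ioo_subset_Icc_self hx)),
      derivWithin_of_mem_nhds (Icc_mem_nhds hx.1 hx.2)]
  have hN : ∫ x in Set.Icc (0:ℝ) L, Real.exp (κ * x) * |u x| ^ p =
      ∫ x in Set.Icc (0:ℝ) L, Real.exp (κ * x) * |U x| ^ p :=
    setIntegral_congr_fun measurableSet_Icc fun x hx => by
      rw [hUu hx]
  rw [hE, hN]
  set A := ∫ x in Set.Icc (0:ℝ) L, Real.exp (κ * x) * |U x| ^ p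
  have hA : 0 ≤ A := integral_nonneg fun x => by positivity
  have hle : lam * A ≤ ∫ x in Set.Icc (0:ℝ) L, Real.exp (κ * x) * |deriv U x| ^ p := by
    have hlim : Filter.Tendsto (fun mu : ℝ => mu * A) (nhdsWithin lam (Set.Iio lam))
        (nhds (lam * A)) :=
      ((continuous_id.mul continuous_const).tendsto lam).mono_left nhdsWithin_le_nhds
    refine le_of_tendsto hlim ?_
    filter_upwards [Ioo_mem_nhdsLT hlam] with mu hmu
    obtain ⟨R, hR, hRL⟩ := hlt mu hmu.1 hmu.2
    exact weighted_wirtinger hpq hL.le hmu.1 hR hRL hU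
      (by rw [← hUu ⟨le_rfl, hL.le⟩, hu0]) (by rw [← hUu ⟨hL.le, le_rfl⟩, huL])
  set B := ∫ x in Set.Icc (0:ℝ) L, |w x| ^ p
  set a : ℝ := (A / B) ^ p⁻¹
  have ha : 0 ≤ a := by positivity
  have hap : |a| ^ p = A / B := by
    rw [abs_of_nonneg ha, Real.rpow_inv_rpow (by positivity) hpq.ne_zero]
  refine ⟨fun x => a * w x, ⟨_, (lipschitzWith_smul a).comp_lipschitzOnWith hwlip⟩,
    fun x _ => mul_nonneg ha (hw x), by simp [hw0], by simp [hwL], ?_, ?_⟩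
  · refine le_trans (le_of_eq ?_) hle
    simp_rw [derivWithin_const_mul_field, abs_mul,
      Real.mul_rpow (abs_nonneg _) (abs_nonneg _), integral_const_mul, hap, hweq]
    field_simp
  · simp_rw [abs_mul, Real.mul_rpow (abs_nonneg _) (abs_nonneg _), integral_const_mul, hap]
    exact (div_mul_cancel₀ A hwpos.ne').symm
end

section
/- Let p ≥ 2, let a > 0 and b > 0, and let s be any real number. Then |a + s|^p / a + |b - s|^p / b ≥ (a + b)^p / (a^{1/(p-1)} + b^{1/(p-1)})^{p-1}. -/
theorem mul_div_rpow_eq_rpow_div_rpow_sub_one {x c : ℝ} (p : ℝ) (hx : 0 ≤ x) (hc : 0 < c) :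
    c * (x / c) ^ p = x ^ p / c ^ (p - 1) := by
  rw [Real.div_rpow hx hc.le, Real.rpow_sub_one hc.ne']
  have := (Real.rpow_pos_of_pos hc p).ne'
  field_simp

/-- Radon's inequality for two terms. -/
theorem add_rpow_div_add_rpow_le {x y c d p : ℝ} (hp : 1 ≤ p) (hx : 0 ≤ x) (hy : 0 ≤ y)
    (hc : 0 < c) (hd : 0 < d) :
    (x + y) ^ p / (c + d) ^ (p - 1) ≤ x ^ p / c ^ (p - 1) + y ^ p / d ^ (p - 1) := by
  have hcd : 0 < c + d := add_pos hc hd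
  have h := (convexOn_rpow hp).2 (Set.mem_Ici.2 (div_nonneg hx hc.le))
    (Set.mem_Ici.2 (div_nonneg hy hd.le)) (div_nonneg hc.le hcd.le) (div_nonneg hd.le hcd.le)
    (by field_simp)
  simp only [smul_eq_mul] at h
  rw [show c / (c + d) * (x / c) + d / (c + d) * (y / d) = (x + y) / (c + d) by field_simp] at h
  simp only [← mul_div_rpow_eq_rpow_div_rpow_sub_one p, hx, hy, add_nonneg, hc, hd, hcd]
  calc (c + d) * ((x + y) / (c + d)) ^ p
      ≤ (c + d) * (c / (c + d) * (x / c) ^ p + d / (c + d) * (y / d) ^ p) := by gcongr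
    _ = c * (x / c) ^ p + d * (y / d) ^ p := by field_simp

/-- First step of inequality (2.1): for `p ≥ 2`, `a, b > 0` and every real `s`,
`|a+s|^p/a + |b-s|^p/b ≥ (a+b)^p / (a^{1/(p-1)} + b^{1/(p-1)})^{p-1}`. -/
theorem drift_minimization_inequality
    (p a b s : ℝ) (hp : 2 ≤ p) (ha : 0 < a) (hb : 0 < b) :
    |a + s| ^ p / a + |b - s| ^ p / b ≥
      (a + b) ^ p / (a ^ (1 / (p - 1)) + b ^ (1 / (p - 1))) ^ (p - 1) := by
  have hp1 : p - 1 ≠ 0 := by linarith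
  have hroot {c : ℝ} (hc : 0 < c) : (c ^ (1 / (p - 1))) ^ (p - 1) = c := by
    rw [one_div, Real.rpow_inv_rpow hc.le hp1]
  have h := add_rpow_div_add_rpow_le (p := p) (by linarith) (abs_nonneg (a + s))
    (abs_nonneg (b - s)) (Real.rpow_pos_of_pos ha (1 / (p - 1)))
    (Real.rpow_pos_of_pos hb (1 / (p - 1)))
  rw [hroot ha, hroot hb] at h
  have habs : a + b ≤ |a + s| + |b - s| := by
    linarith [le_abs_self (a + s), le_abs_self (b - s)]
  refine le_trans ?_ h
  gcongr
end

section
/- Let p ≥ 2 and let a > 0 and b > 0. Then (a + b)^p / (a^{1/(p-1)} + b^{1/(p-1)})^{p-1} ≥ 2^p (a b / (a + b))^{p-1}. Consequently, for every real s, |a + s|^p / a + |b - s|^p / b ≥ 2^p (a b / (a + b))^{p-1}. -/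
/-- The two-term Hölder (Radon) inequality, with the weights written as powers. -/
theorem add_rpow_div_le_rpow_div_add_rpow_div {p A B x y : ℝ} (hp : 1 ≤ p) (hA : 0 < A)
    (hB : 0 < B) (hx : 0 ≤ x) (hy : 0 ≤ y) :
    (x + y) ^ p / (A + B) ^ (p - 1) ≤ x ^ p / A ^ (p - 1) + y ^ p / B ^ (p - 1) := by
  have hAB : 0 < A + B := add_pos hA hB
  have hxA : x / A ∈ Set.Ici (0 : ℝ) := Set.mem_Ici.2 (by positivity)
  have hyB : y / B ∈ Set.Ici (0 : ℝ) := Set.mem_Ici.2 (by positivity)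
  have hwA : 0 ≤ A / (A + B) := by positivity
  have hwB : 0 ≤ B / (A + B) := by positivity
  have key := (convexOn_rpow hp).2 hxA hyB hwA hwB (by field_simp)
  simp only [smul_eq_mul] at key
  have e : A / (A + B) * (x / A) + B / (A + B) * (y / B) = (x + y) / (A + B) := by
    field_simp
  rw [e, Real.div_rpow (by positivity) hAB.le, Real.div_rpow hx hA.le,
    Real.div_rpow hy hB.le] at key
  have split {C : ℝ} (hC : 0 < C) : C ^ p = C ^ (p - 1) * C := by
    rw [Real.rpow_sub_one hC.ne', div_mul_cancel₀ _ hC.ne']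
  rw [split hAB, split hA, split hB] at key
  calc (x + y) ^ p / (A + B) ^ (p - 1)
      = (A + B) * ((x + y) ^ p / ((A + B) ^ (p - 1) * (A + B))) := by field_simp
    _ ≤ (A + B) * (A / (A + B) * (x ^ p / (A ^ (p - 1) * A))
          + B / (A + B) * (y ^ p / (B ^ (p - 1) * B))) := by gcongr
    _ = x ^ p / A ^ (p - 1) + y ^ p / B ^ (p - 1) := by field_simp

/-- The power mean of exponent `1 / q` is at most the arithmetic mean. -/
theorem rpow_one_div_add_rpow_le {q a b : ℝ} (hq : 1 ≤ q) (ha : 0 ≤ a) (hb : 0 ≤ b) :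
    (a ^ (1 / q) + b ^ (1 / q)) ^ q ≤ 2 ^ (q - 1) * (a + b) := by
  have hq0 : q ≠ 0 := by positivity
  have key := add_rpow_div_le_rpow_div_add_rpow_div hq one_pos one_pos
    (Real.rpow_nonneg ha (1 / q)) (Real.rpow_nonneg hb (1 / q))
  rw [one_add_one_eq_two, div_le_iff₀' (by positivity)] at key
  simpa [Real.rpow_inv_rpow, ha, hb, hq0] using key

/-- Inequality (2.1): for `p ≥ 2` and `a, b > 0`,
`(a+b)^p / (a^{1/(p-1)} + b^{1/(p-1)})^{p-1} ≥ 2^p (ab/(a+b))^{p-1}`, and consequently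
`|a+s|^p/a + |b-s|^p/b ≥ 2^p (ab/(a+b))^{p-1}` for every real `s`. -/
theorem harmonic_mean_lower_bound
    (p a b : ℝ) (hp : 2 ≤ p) (ha : 0 < a) (hb : 0 < b) :
    (a + b) ^ p / (a ^ (1 / (p - 1)) + b ^ (1 / (p - 1))) ^ (p - 1) ≥
      2 ^ p * (a * b / (a + b)) ^ (p - 1) ∧
    ∀ s : ℝ, |a + s| ^ p / a + |b - s| ^ p / b ≥ 2 ^ p * (a * b / (a + b)) ^ (p - 1) := by
  have hq : 1 ≤ p - 1 := by linarith
  have hab : 0 < a + b := add_pos ha hb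
  have first : 2 ^ p * (a * b / (a + b)) ^ (p - 1) ≤
      (a + b) ^ p / (a ^ (1 / (p - 1)) + b ^ (1 / (p - 1))) ^ (p - 1) := by
    rw [le_div_iff₀ (by positivity)]
    have h2 : (2 : ℝ) ^ p * 2 ^ (p - 1 - 1) = 4 ^ (p - 1) := by
      rw [← Real.rpow_add two_pos, show (4 : ℝ) = 2 ^ (2 : ℝ) by norm_num,
        ← Real.rpow_mul two_pos.le]
      ring_nf
    have harm : 4 * (a * b / (a + b)) ≤ a + b := by
      rw [← mul_div_assoc, div_le_iff₀ hab]
      nlinarith [sq_nonneg (a - b)]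
    calc 2 ^ p * (a * b / (a + b)) ^ (p - 1) *
          (a ^ (1 / (p - 1)) + b ^ (1 / (p - 1))) ^ (p - 1)
        ≤ 2 ^ p * (a * b / (a + b)) ^ (p - 1) * (2 ^ (p - 1 - 1) * (a + b)) := by
          gcongr
          exact rpow_one_div_add_rpow_le hq ha.le hb.le
      _ = (4 * (a * b / (a + b))) ^ (p - 1) * (a + b) := by
          rw [Real.mul_rpow (by norm_num) (by positivity), ← h2]
          ring
      _ ≤ (a + b) ^ (p - 1) * (a + b) := by gcongr
      _ = (a + b) ^ p := by
          rw [Real.rpow_sub_one hab.ne', div_mul_cancel₀ _ hab.ne']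
  refine ⟨first, fun s => first.trans ?_⟩
  have hq0 : p - 1 ≠ 0 := by positivity
  have radon := add_rpow_div_le_rpow_div_add_rpow_div (p := p) (by linarith)
    (Real.rpow_pos_of_pos ha (1 / (p - 1))) (Real.rpow_pos_of_pos hb (1 / (p - 1)))
    (abs_nonneg (a + s)) (abs_nonneg (b - s))
  have cancel {c : ℝ} (hc : 0 < c) : (c ^ (1 / (p - 1))) ^ (p - 1) = c := by
    rw [one_div, Real.rpow_inv_rpow hc.le hq0]
  rw [cancel ha, cancel hb] at radon
  refine le_trans ?_ radon
  have sum_le : a + b ≤ |a + s| + |b - s| := by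
    linarith [le_abs_self (a + s), le_abs_self (b - s)]
  gcongr ?_ / _
  exact Real.rpow_le_rpow hab.le sum_le (by linarith)
end
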